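/- arXiv:1707.02616 — 2 statements merged into one kernel-verified Lean document; each statement's English description precedes it below -/
import Mathlib

section
/- Let λ₀ > 0 and assume that ∫₂^∞ ∫_ℝ sech²(x/λ₀) ((∂ₓu₁)² + u₁² + u₂²)(t,x) dx dt < ∞. Then lim_{t→∞} ∫_ℝ sech²(x/λ₀) u₁²(t,x) dx = 0; in particular, for every compact interval I ⊂ ℝ, lim_{t→∞} ∫_I u₁²(t,x) dx = 0. -/
open MeasureTheory Filter

noncomputable def sech (x : ℝ) : ℝ := 1 / Real.cosh x

lemma abs_le_of_weighted_bound {g : ℝ → ℝ} {M : ℝ}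
    (h : ∀ x, (1 + |x|) ^ 2 * |g x| ≤ M) (x : ℝ) : |g x| ≤ M := by
  have h1 : 1 ≤ (1 + |x|) ^ 2 := one_le_pow₀ (by linarith [abs_nonneg x])
  nlinarith [h x, abs_nonneg (g x)]

lemma integrable_of_weighted_bound {g : ℝ → ℝ} (hg : Continuous g) {M : ℝ}
    (h : ∀ x, (1 + |x|) ^ 2 * |g x| ≤ M) : Integrable g := by
  have h0 : Integrable (fun x : ℝ => M * (1 + ‖x‖) ^ (-(2 : ℝ))) :=
    (integrable_one_add_norm (by simp)).const_mul M
  refine h0.mono' hg.aestronglyMeasurable (Eventually.of_forall fun x => ?_)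
  have hpos : 0 < 1 + |x| := by positivity
  rw [Real.norm_eq_abs, Real.norm_eq_abs, Real.rpow_neg hpos.le, Real.rpow_two,
    ← div_eq_mul_inv, le_div_iff₀ (by positivity)]
  linarith [h x]

lemma sech_pos (x : ℝ) : 0 < sech x := one_div_pos.mpr (Real.cosh_pos x)

lemma sech_le_one (x : ℝ) : sech x ≤ 1 :=
  (div_le_one (Real.cosh_pos x)).mpr (Real.one_le_cosh x)

lemma sech_sq_le_one (x : ℝ) : sech x ^ 2 ≤ 1 :=
  pow_le_one₀ (sech_pos x).le (sech_le_one x)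

lemma continuous_sech : Continuous sech :=
  continuous_const.div Real.continuous_cosh fun x => (Real.cosh_pos x).ne'

lemma hasDerivAt_sech_sq_div (l x : ℝ) :
    HasDerivAt (fun x => sech (x / l) ^ 2)
      (-(2 / l) * Real.tanh (x / l) * sech (x / l) ^ 2) x := by
  have h1 : HasDerivAt (fun x : ℝ => x / l) (1 / l) x := (hasDerivAt_id x).div_const l
  have hc := (Real.cosh_pos (x / l)).ne'
  have h := (((hasDerivAt_const x (1 : ℝ)).div h1.cosh hc).pow 2)
  refine h.congr_deriv ?_
  simp only [sech, Real.tanh_eq_sinh_div_cosh, Pi.div_apply]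
  by_cases hl : l = 0
  · simp [hl]
  · push_cast
    field_simp
    ring

lemma abs_tanh_le_one (x : ℝ) : |Real.tanh x| ≤ 1 := by
  rw [Real.tanh_eq_sinh_div_cosh, abs_div, abs_of_pos (Real.cosh_pos x),
    div_le_one (Real.cosh_pos x), abs_le]
  have h1 := Real.cosh_add_sinh x
  have h2 := Real.cosh_sub_sinh x
  constructor <;> linarith [Real.exp_pos x, Real.exp_pos (-x)]

lemma integrable_sech_sq_mul_mul (l : ℝ) {a b : ℝ → ℝ} (ha : Continuous a) (hb : Continuous b)
    {A B : ℝ} (hA : ∀ x, (1 + |x|) ^ 2 * |a x| ≤ A) (hB : ∀ x, (1 + |x|) ^ 2 * |b x| ≤ B) :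
    Integrable (fun x => sech (x / l) ^ 2 * (a x * b x)) := by
  have hw : Continuous fun x => sech (x / l) ^ 2 :=
    (continuous_sech.comp (continuous_id.div_const l)).pow 2
  refine integrable_of_weighted_bound (M := A * B) (hw.mul (ha.mul hb)) fun x => ?_
  have h1 := abs_le_of_weighted_bound hB x
  have hA0 : 0 ≤ A := le_trans (by positivity) (hA x)
  have h2 := sech_sq_le_one (x / l)
  rw [abs_mul, abs_mul, abs_of_nonneg (sq_nonneg (sech (x / l)))]
  calc (1 + |x|) ^ 2 * (sech (x / l) ^ 2 * (|a x| * |b x|))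
      = sech (x / l) ^ 2 * (((1 + |x|) ^ 2 * |a x|) * |b x|) := by ring
    _ ≤ 1 * (A * B) := by
        gcongr
        exact hA x
    _ = A * B := one_mul _

/-- Differentiation of a localized squared norm whose time derivative is a space derivative. -/
lemma hasDerivAt_integral_sech_sq_mul_sq (l : ℝ) (v w : ℝ → ℝ → ℝ)
    (hv : ContDiff ℝ (⊤ : ℕ∞) (fun q : ℝ × ℝ => v q.1 q.2))
    (hw : ∀ t, Continuous (w t))
    (hvw : ∀ t x, deriv (fun s => v s x) t = w t x)
    (hdv : ∀ T : ℝ, ∃ M : ℝ, ∀ t ∈ Set.Icc (-T) T, ∀ x : ℝ, (1 + |x|) ^ 2 * |v t x| ≤ M)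
    (hdw : ∀ T : ℝ, ∃ M : ℝ, ∀ t ∈ Set.Icc (-T) T, ∀ x : ℝ, (1 + |x|) ^ 2 * |w t x| ≤ M)
    (t : ℝ) :
    HasDerivAt (fun t => ∫ x : ℝ, sech (x / l) ^ 2 * (v t x) ^ 2)
      (∫ x : ℝ, sech (x / l) ^ 2 * (2 * (v t x * w t x))) t := by
  have hcv : ∀ s, Continuous (v s) := fun s =>
    hv.continuous.comp (Continuous.prodMk_right s)
  have hcs : Continuous fun x => sech (x / l) ^ 2 :=
    (continuous_sech.comp (continuous_id.div_const l)).pow 2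
  obtain ⟨A, hA⟩ := hdv (|t| + 1)
  obtain ⟨B, hB⟩ := hdw (|t| + 1)
  have hmem : ∀ s ∈ Metric.ball t 1, s ∈ Set.Icc (-(|t| + 1)) (|t| + 1) := by
    intro s hs
    rw [Metric.mem_ball, Real.dist_eq, abs_lt] at hs
    constructor <;> linarith [neg_abs_le t, le_abs_self t, hs.1, hs.2]
  have htm := hmem t (Metric.mem_ball_self one_pos)
  refine (hasDerivAt_integral_of_dominated_loc_of_deriv_le
    (F := fun t x => sech (x / l) ^ 2 * (v t x) ^ 2)
    (F' := fun t x => sech (x / l) ^ 2 * (2 * (v t x * w t x)))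
    (bound := fun x => 2 * A * B * (1 + ‖x‖) ^ (-(2 : ℝ)))
    (Metric.ball_mem_nhds t one_pos) ?_ ?_ ?_ ?_ ?_ ?_).2
  · exact Eventually.of_forall fun s => (hcs.mul ((hcv s).pow 2)).aestronglyMeasurable
  · simpa only [pow_two (v _ _)] using
      integrable_sech_sq_mul_mul l (hcv t) (hcv t) (hA t htm) (hA t htm)
  · exact (hcs.mul (continuous_const.mul ((hcv t).mul (hw t)))).aestronglyMeasurable
  · refine Eventually.of_forall fun x s hs => ?_
    have hpos : 0 < 1 + |x| := by positivity
    have h1 := hA s (hmem s hs) x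
    have h2 := abs_le_of_weighted_bound (hB s (hmem s hs)) x
    have hA0 : 0 ≤ A := le_trans (by positivity) h1
    rw [Real.norm_eq_abs, Real.norm_eq_abs, Real.rpow_neg hpos.le, Real.rpow_two,
      ← div_eq_mul_inv, le_div_iff₀ (by positivity), abs_mul, abs_mul, abs_mul,
      abs_of_nonneg (sq_nonneg _), abs_two]
    calc sech (x / l) ^ 2 * (2 * (|v s x| * |w s x|)) * (1 + |x|) ^ 2
        = sech (x / l) ^ 2 * (2 * (((1 + |x|) ^ 2 * |v s x|) * |w s x|)) := by ring
      _ ≤ 1 * (2 * (A * B)) := by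
          gcongr
          exact sech_sq_le_one _
      _ = 2 * A * B := by ring
  · exact (integrable_one_add_norm (by simp)).const_mul _
  · refine Eventually.of_forall fun x s _ => ?_
    have hd : DifferentiableAt ℝ (fun s => v s x) s := by
      have : ContDiff ℝ (⊤ : ℕ∞) (fun s => v s x) := hv.comp (contDiff_prodMk_left x)
      exact (this.differentiable (by simp)) s
    have h := (hd.hasDerivAt.pow 2).const_mul (sech (x / l) ^ 2)
    rw [hvw] at h
    refine h.congr_deriv ?_
    push_cast
    ring

/-- Integration by parts moves the derivative off `b`, leaving terms controlled by the localized
energy. -/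
lemma abs_integral_sech_sq_mul_mul_deriv_le {l : ℝ} (hl : 0 < l) {a b : ℝ → ℝ}
    (ha : ContDiff ℝ (⊤ : ℕ∞) a) (hb : ContDiff ℝ (⊤ : ℕ∞) b) {A A' B B' : ℝ}
    (hA : ∀ x, (1 + |x|) ^ 2 * |a x| ≤ A) (hA' : ∀ x, (1 + |x|) ^ 2 * |deriv a x| ≤ A')
    (hB : ∀ x, (1 + |x|) ^ 2 * |b x| ≤ B) (hB' : ∀ x, (1 + |x|) ^ 2 * |deriv b x| ≤ B') :
    |∫ x : ℝ, sech (x / l) ^ 2 * (2 * (a x * deriv b x))| ≤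
      (2 / l + 1) * ∫ x : ℝ, sech (x / l) ^ 2 * ((deriv a x) ^ 2 + (a x) ^ 2 + (b x) ^ 2) := by
  have hca := ha.continuous
  have hcb := hb.continuous
  have hca' : Continuous (deriv a) := ha.continuous_deriv (by simp)
  have hcb' : Continuous (deriv b) := hb.continuous_deriv (by simp)
  have hcs : Continuous fun x => sech (x / l) ^ 2 :=
    (continuous_sech.comp (continuous_id.div_const l)).pow 2
  have htanh : Continuous fun x => Real.tanh (x / l) := by
    simp only [Real.tanh_eq_sinh_div_cosh]
    exact (Real.continuous_sinh.comp (continuous_id.div_const l)).div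
      (Real.continuous_cosh.comp (continuous_id.div_const l)) fun x => (Real.cosh_pos _).ne'
  have hiG : Integrable fun x => sech (x / l) ^ 2 *
      ((deriv a x) ^ 2 + (a x) ^ 2 + (b x) ^ 2) := by
    refine (((integrable_sech_sq_mul_mul l hca' hca' hA' hA').add
      (integrable_sech_sq_mul_mul l hca hca hA hA)).add
      (integrable_sech_sq_mul_mul l hcb hcb hB hB)).congr (Eventually.of_forall fun x => ?_)
    simp only [Pi.add_apply]
    ring
  have hderiv : ∀ x, HasDerivAt (fun x => sech (x / l) ^ 2 * (2 * a x))
      (-(2 / l) * Real.tanh (x / l) * sech (x / l) ^ 2 * (2 * a x) +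
        sech (x / l) ^ 2 * (2 * deriv a x)) x := fun x =>
    (hasDerivAt_sech_sq_div l x).mul
      (((ha.differentiable (by simp)) x).hasDerivAt.const_mul 2)
  have hbound : ∀ x, ‖(-(2 / l) * Real.tanh (x / l) * sech (x / l) ^ 2 * (2 * a x) +
        sech (x / l) ^ 2 * (2 * deriv a x)) * b x‖ ≤
      (2 / l + 1) * (sech (x / l) ^ 2 * ((deriv a x) ^ 2 + (a x) ^ 2 + (b x) ^ 2)) := by
    intro x
    have h1 : |Real.tanh (x / l) * (2 * (a x * b x))| ≤
        (deriv a x) ^ 2 + (a x) ^ 2 + (b x) ^ 2 := by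
      rw [abs_mul]
      have h3 : |2 * (a x * b x)| ≤ (a x) ^ 2 + (b x) ^ 2 := by
        rw [abs_le]
        constructor <;> nlinarith [sq_nonneg (a x + b x), sq_nonneg (a x - b x)]
      nlinarith [abs_tanh_le_one (x / l), abs_nonneg (2 * (a x * b x)), sq_nonneg (deriv a x)]
    have h2 : |2 * (deriv a x * b x)| ≤ (deriv a x) ^ 2 + (a x) ^ 2 + (b x) ^ 2 := by
      rw [abs_le]
      constructor <;> nlinarith [sq_nonneg (deriv a x + b x), sq_nonneg (deriv a x - b x),
        sq_nonneg (a x)]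
    have hl2 : 0 ≤ 2 / l := by positivity
    calc _ = |sech (x / l) ^ 2 * (-((2 / l) * (Real.tanh (x / l) * (2 * (a x * b x)))) +
            2 * (deriv a x * b x))| := by rw [Real.norm_eq_abs]; congr 1; ring
      _ = sech (x / l) ^ 2 * |-((2 / l) * (Real.tanh (x / l) * (2 * (a x * b x)))) +
            2 * (deriv a x * b x)| := by rw [abs_mul, abs_of_nonneg (sq_nonneg _)]
      _ ≤ sech (x / l) ^ 2 * ((2 / l) * ((deriv a x) ^ 2 + (a x) ^ 2 + (b x) ^ 2) +
            ((deriv a x) ^ 2 + (a x) ^ 2 + (b x) ^ 2)) := by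
          gcongr
          refine (abs_add_le _ _).trans (add_le_add ?_ h2)
          rw [abs_neg, abs_mul, abs_of_nonneg hl2]
          gcongr
      _ = _ := by ring
  have hi' : Integrable fun x => (-(2 / l) * Real.tanh (x / l) * sech (x / l) ^ 2 * (2 * a x) +
        sech (x / l) ^ 2 * (2 * deriv a x)) * b x := by
    refine (hiG.const_mul (2 / l + 1)).mono' (Continuous.aestronglyMeasurable ?_)
      (Eventually.of_forall hbound)
    fun_prop
  have hibp := integral_mul_deriv_eq_deriv_mul_of_integrable
    (u := fun x => sech (x / l) ^ 2 * (2 * a x)) (v := b)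
    (fun x _ => hderiv x) (fun x _ => ((hb.differentiable (by simp)) x).hasDerivAt)
    (((integrable_sech_sq_mul_mul l hca hcb' hA hB').const_mul 2).congr
      (Eventually.of_forall fun x => by simp only [Pi.mul_apply]; ring))
    hi'
    (((integrable_sech_sq_mul_mul l hca hcb hA hB).const_mul 2).congr
      (Eventually.of_forall fun x => by simp only [Pi.mul_apply]; ring))
  have heq : ∫ x : ℝ, sech (x / l) ^ 2 * (2 * (a x * deriv b x)) =
      ∫ x : ℝ, sech (x / l) ^ 2 * (2 * a x) * deriv b x := by
    congr 1
    ext x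
    ring
  rw [heq, hibp, abs_neg, ← integral_const_mul, ← Real.norm_eq_abs]
  exact norm_integral_le_of_norm_le (hiG.const_mul _) (Eventually.of_forall hbound)

/-- Decay of the localized $L^2$ norm of $u_1$ \eqref{First_to_zero}. -/
theorem stmt_9 (p K : ℝ) (hp : 1 < p) (hK : 0 < K)
    (f : ℝ → ℝ) (hf : ContDiff ℝ (⊤ : ℕ∞) f) (hf0 : f 0 = 0)
    (hfp : ∀ s : ℝ, |s| ≤ 1 → |deriv f s| ≤ K * |s| ^ (p - 1))
    (u₁ u₂ : ℝ → ℝ → ℝ)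
    (hu₁ : ContDiff ℝ (⊤ : ℕ∞) (fun q : ℝ × ℝ => u₁ q.1 q.2))
    (hu₂ : ContDiff ℝ (⊤ : ℕ∞) (fun q : ℝ × ℝ => u₂ q.1 q.2))
    (heq₁ : ∀ t x : ℝ, deriv (fun s => u₁ s x) t = deriv (u₂ t) x)
    (heq₂ : ∀ t x : ℝ, deriv (fun s => u₂ s x) t
      = deriv (fun y => u₁ t y - deriv (deriv (u₁ t)) y - f (u₁ t y)) x)
    (hdec₁ : ∀ T : ℝ, ∀ m k n : ℕ, ∃ M : ℝ, ∀ t ∈ Set.Icc (-T) T, ∀ x : ℝ,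
      (1 + |x|) ^ n * |iteratedDeriv k (fun y => iteratedDeriv m (fun s => u₁ s y) t) x| ≤ M)
    (hdec₂ : ∀ T : ℝ, ∀ m k n : ℕ, ∃ M : ℝ, ∀ t ∈ Set.Icc (-T) T, ∀ x : ℝ,
      (1 + |x|) ^ n * |iteratedDeriv k (fun y => iteratedDeriv m (fun s => u₂ s y) t) x| ≤ M)
    (lam₀ : ℝ) (hlam₀ : 0 < lam₀)
    (hint : IntegrableOn (fun t => ∫ x : ℝ, sech (x / lam₀) ^ 2 *
        ((deriv (u₁ t) x) ^ 2 + (u₁ t x) ^ 2 + (u₂ t x) ^ 2)) (Set.Ioi (2:ℝ))) :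
    Tendsto (fun t => ∫ x : ℝ, sech (x / lam₀) ^ 2 * (u₁ t x) ^ 2) atTop (nhds 0) ∧
    ∀ a b : ℝ, Tendsto (fun t => ∫ x in Set.Icc a b, (u₁ t x) ^ 2) atTop (nhds 0) := by
  have hc₁ : ∀ t, ContDiff ℝ (⊤ : ℕ∞) (u₁ t) := fun t => hu₁.comp (contDiff_prodMk_right t)
  have hc₂ : ∀ t, ContDiff ℝ (⊤ : ℕ∞) (u₂ t) := fun t => hu₂.comp (contDiff_prodMk_right t)
  have hd₁ : ∀ T : ℝ, ∃ M : ℝ, ∀ t ∈ Set.Icc (-T) T, ∀ x : ℝ,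
      (1 + |x|) ^ 2 * |u₁ t x| ≤ M := fun T => by simpa using hdec₁ T 0 0 2
  have hd₁' : ∀ T : ℝ, ∃ M : ℝ, ∀ t ∈ Set.Icc (-T) T, ∀ x : ℝ,
      (1 + |x|) ^ 2 * |deriv (u₁ t) x| ≤ M := fun T => by
    simpa [iteratedDeriv_one] using hdec₁ T 0 1 2
  have hd₂ : ∀ T : ℝ, ∃ M : ℝ, ∀ t ∈ Set.Icc (-T) T, ∀ x : ℝ,
      (1 + |x|) ^ 2 * |u₂ t x| ≤ M := fun T => by simpa using hdec₂ T 0 0 2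
  have hd₂' : ∀ T : ℝ, ∃ M : ℝ, ∀ t ∈ Set.Icc (-T) T, ∀ x : ℝ,
      (1 + |x|) ^ 2 * |deriv (u₂ t) x| ≤ M := fun T => by
    simpa [iteratedDeriv_one] using hdec₂ T 0 1 2
  have hmem : ∀ t : ℝ, t ∈ Set.Icc (-|t|) |t| := fun t => ⟨neg_abs_le t, le_abs_self t⟩
  have hE := hasDerivAt_integral_sech_sq_mul_sq lam₀ u₁ (fun t => deriv (u₂ t)) hu₁
    (fun t => (hc₂ t).continuous_deriv (by simp)) heq₁ hd₁ hd₂'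
  have hint₁ : ∀ t, Integrable fun x => sech (x / lam₀) ^ 2 * (u₁ t x) ^ 2 := fun t => by
    obtain ⟨A, hA⟩ := hd₁ |t|
    simpa only [pow_two (u₁ _ _)] using integrable_sech_sq_mul_mul lam₀ (hc₁ t).continuous
      (hc₁ t).continuous (hA t (hmem t)) (hA t (hmem t))
  have hderiv_le : ∀ t, |∫ x : ℝ, sech (x / lam₀) ^ 2 * (2 * (u₁ t x * deriv (u₂ t) x))| ≤
      (2 / lam₀ + 1) * ∫ x : ℝ, sech (x / lam₀) ^ 2 *
        ((deriv (u₁ t) x) ^ 2 + (u₁ t x) ^ 2 + (u₂ t x) ^ 2) := fun t => by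
    obtain ⟨A, hA⟩ := hd₁ |t|
    obtain ⟨A', hA'⟩ := hd₁' |t|
    obtain ⟨B, hB⟩ := hd₂ |t|
    obtain ⟨B', hB'⟩ := hd₂' |t|
    exact abs_integral_sech_sq_mul_mul_deriv_le hlam₀ (hc₁ t) (hc₂ t) (hA t (hmem t))
      (hA' t (hmem t)) (hB t (hmem t)) (hB' t (hmem t))
  have hE_le : ∀ t, ∫ x : ℝ, sech (x / lam₀) ^ 2 * (u₁ t x) ^ 2 ≤
      ∫ x : ℝ, sech (x / lam₀) ^ 2 *
        ((deriv (u₁ t) x) ^ 2 + (u₁ t x) ^ 2 + (u₂ t x) ^ 2) := fun t => by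
    obtain ⟨A', hA'⟩ := hd₁' |t|
    obtain ⟨B, hB⟩ := hd₂ |t|
    have hca' : Continuous (deriv (u₁ t)) := (hc₁ t).continuous_deriv (by simp)
    refine integral_mono (hint₁ t) ?_ fun x => ?_
    · refine (((integrable_sech_sq_mul_mul lam₀ hca' hca' (hA' t (hmem t)) (hA' t (hmem t))).add
        (hint₁ t)).add (integrable_sech_sq_mul_mul lam₀ (hc₂ t).continuous (hc₂ t).continuous
          (hB t (hmem t)) (hB t (hmem t)))).congr (Eventually.of_forall fun x => ?_)
      simp only [Pi.add_apply]
      ring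
    · have := sq_nonneg (deriv (u₁ t) x)
      have := sq_nonneg (u₂ t x)
      dsimp only
      gcongr
      linarith
  have hE_nonneg : ∀ t, 0 ≤ ∫ x : ℝ, sech (x / lam₀) ^ 2 * (u₁ t x) ^ 2 := fun t =>
    integral_nonneg fun x => by positivity
  have hE_meas : AEStronglyMeasurable (fun t => ∫ x : ℝ, sech (x / lam₀) ^ 2 * (u₁ t x) ^ 2)
      (volume.restrict (Set.Ioi 2)) :=
    (continuous_iff_continuousAt.mpr fun t => (hE t).continuousAt).aestronglyMeasurable
  have hE'_meas : AEStronglyMeasurable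
      (fun t => ∫ x : ℝ, sech (x / lam₀) ^ 2 * (2 * (u₁ t x * deriv (u₂ t) x)))
      (volume.restrict (Set.Ioi 2)) := by
    rw [← funext fun t => (hE t).deriv]
    exact (measurable_deriv _).aestronglyMeasurable
  have hlim : Tendsto (fun t => ∫ x : ℝ, sech (x / lam₀) ^ 2 * (u₁ t x) ^ 2) atTop (nhds 0) := by
    refine tendsto_zero_of_hasDerivAt_of_integrableOn_Ioi (a := 2) (fun t _ => hE t) ?_ ?_
    · exact (Integrable.const_mul hint (2 / lam₀ + 1)).mono' hE'_meas
        (Eventually.of_forall hderiv_le)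
    · refine Integrable.mono' hint hE_meas (Eventually.of_forall fun t => ?_)
      rw [Real.norm_of_nonneg (hE_nonneg t)]
      exact hE_le t
  refine ⟨hlim, fun a b => ?_⟩
  obtain ⟨C, hC⟩ := (isCompact_Icc (a := a) (b := b)).exists_bound_of_continuousOn
    (f := fun x => Real.cosh (x / lam₀) ^ 2)
    ((Real.continuous_cosh.comp (continuous_id.div_const lam₀)).pow 2).continuousOn
  refine squeeze_zero (fun t => integral_nonneg fun x => sq_nonneg _) (fun t => ?_)
    (by simpa using hlim.const_mul |C|)
  calc ∫ x in Set.Icc a b, (u₁ t x) ^ 2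
      ≤ ∫ x in Set.Icc a b, |C| * (sech (x / lam₀) ^ 2 * (u₁ t x) ^ 2) := by
        refine setIntegral_mono_on
          ((hc₁ t).continuous.pow 2).continuousOn.integrableOn_Icc
          ((hint₁ t).const_mul |C|).integrableOn measurableSet_Icc fun x hx => ?_
        have h1 := (le_abs_self _).trans ((hC x hx).trans (le_abs_self C))
        have h2 : Real.cosh (x / lam₀) ^ 2 * sech (x / lam₀) ^ 2 = 1 := by
          rw [← mul_pow, sech, mul_one_div_cancel (Real.cosh_pos _).ne', one_pow]
        calc (u₁ t x) ^ 2
            = Real.cosh (x / lam₀) ^ 2 * (sech (x / lam₀) ^ 2 * (u₁ t x) ^ 2) := by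
              rw [← mul_assoc, h2, one_mul]
          _ ≤ _ := by gcongr
    _ ≤ ∫ x, |C| * (sech (x / lam₀) ^ 2 * (u₁ t x) ^ 2) :=
        setIntegral_le_integral ((hint₁ t).const_mul |C|)
          (Eventually.of_forall fun x => by dsimp only [Pi.zero_apply]; positivity)
    _ = |C| * ∫ x, sech (x / lam₀) ^ 2 * (u₁ t x) ^ 2 := integral_const_mul _ _
end

section
/- Let λ : ℝ → ℝ be smooth and everywhere positive, and define φ(t,x) := (1/λ(t)) sech²(x/λ(t)) and I₊(t) := ∫_ℝ φ(t,x) ∂ₓu₁(t,x) u₂(t,x) dx. Then I₊ is differentiable and I₊'(t) = ∫ ∂ₜφ · ∂ₓu₁ · u₂ dx − ∫ φ (∂ₓu₂)² dx + ∫ φ (∂ₓ²u₁)² dx + (1/2) ∫ ∂ₓ²φ · u₂² dx + ∫ (φ − (1/2)∂ₓ²φ) (∂ₓu₁)² dx − ∫ φ (∂ₓu₁)² f'(u₁) dx, where all integrals are over x ∈ ℝ at time t. -/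
open MeasureTheory Filter

/-- `g` grows at most linearly in `x`, locally uniformly in `t`. -/
def LinearGrowth (g : ℝ → ℝ → ℝ) : Prop :=
  ∀ T : ℝ, ∃ M : ℝ, ∀ t ∈ Set.Icc (-T) T, ∀ x : ℝ, |g t x| ≤ M * (1 + |x|)

/-- `g` decays at least quadratically in `x`, locally uniformly in `t`. -/
def QuadraticDecay (g : ℝ → ℝ → ℝ) : Prop :=
  ∀ T : ℝ, ∃ M : ℝ, ∀ t ∈ Set.Icc (-T) T, ∀ x : ℝ, (1 + |x|) ^ 2 * |g t x| ≤ M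

lemma QuadraticDecay.sub {g h : ℝ → ℝ → ℝ} (hg : QuadraticDecay g) (hh : QuadraticDecay h) :
    QuadraticDecay (fun t x => g t x - h t x) := by
  intro T
  obtain ⟨M, hM⟩ := hg T
  obtain ⟨N, hN⟩ := hh T
  refine ⟨M + N, fun t ht x => ?_⟩
  have h1 : (1 + |x|) ^ 2 * |g t x - h t x| ≤ (1 + |x|) ^ 2 * (|g t x| + |h t x|) := by
    gcongr
    exact abs_sub _ _
  linarith [hM t ht x, hN t ht x]

lemma LinearGrowth.exists_bound_mul {a b c : ℝ → ℝ → ℝ} (ha : LinearGrowth a)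
    (hb : QuadraticDecay b) (hc : QuadraticDecay c) (T : ℝ) :
    ∃ M : ℝ, ∀ t ∈ Set.Icc (-T) T, ∀ x : ℝ,
      |a t x * (b t x * c t x)| ≤ M * (1 + x ^ 2)⁻¹ := by
  obtain ⟨A, hA⟩ := ha T
  obtain ⟨B, hB⟩ := hb T
  obtain ⟨C, hC⟩ := hc T
  refine ⟨A * B * C, fun t ht x => ?_⟩
  have hx : 0 ≤ |x| := abs_nonneg x
  have hA1 := hA t ht x
  have hA0 : 0 ≤ A := by
    have h1 := (abs_nonneg _).trans hA1
    exact nonneg_of_mul_nonneg_left h1 (by positivity)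
  have hB0 : 0 ≤ B := le_trans (by positivity) (hB t ht x)
  have hC0 : 0 ≤ C := le_trans (by positivity) (hC t ht x)
  have hprod : (1 + |x|) ^ 4 * (|b t x| * |c t x|) ≤ B * C := by
    calc (1 + |x|) ^ 4 * (|b t x| * |c t x|)
        = ((1 + |x|) ^ 2 * |b t x|) * ((1 + |x|) ^ 2 * |c t x|) := by ring
      _ ≤ B * C := mul_le_mul (hB t ht x) (hC t ht x) (by positivity) hB0
  have hweight : (1 + |x|) * (1 + x ^ 2) ≤ (1 + |x|) ^ 4 := by
    rw [← sq_abs x]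
    nlinarith [pow_nonneg hx 2, pow_nonneg hx 3, pow_nonneg hx 4]
  rw [← div_eq_mul_inv, le_div_iff₀ (by positivity), abs_mul, abs_mul]
  calc |a t x| * (|b t x| * |c t x|) * (1 + x ^ 2)
      ≤ A * (1 + |x|) * (|b t x| * |c t x|) * (1 + x ^ 2) := by gcongr
    _ = A * (((1 + |x|) * (1 + x ^ 2)) * (|b t x| * |c t x|)) := by ring
    _ ≤ A * ((1 + |x|) ^ 4 * (|b t x| * |c t x|)) := by gcongr
    _ ≤ A * (B * C) := by gcongr
    _ = A * B * C := by ring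

lemma LinearGrowth.integrable_mul {a b c : ℝ → ℝ → ℝ} (ha : LinearGrowth a)
    (hb : QuadraticDecay b) (hc : QuadraticDecay c) {t : ℝ}
    (ha' : Continuous (a t)) (hb' : Continuous (b t)) (hc' : Continuous (c t)) :
    Integrable (fun x => a t x * (b t x * c t x)) := by
  obtain ⟨M, hM⟩ := ha.exists_bound_mul hb hc |t|
  refine (integrable_inv_one_add_sq.const_mul M).mono'
    (by fun_prop : Continuous _).aestronglyMeasurable (.of_forall fun x => ?_)
  exact hM t ⟨neg_abs_le t, le_abs_self t⟩ x

lemma LinearGrowth.hasDerivAt_integral_mul {a b c a' b' c' : ℝ → ℝ → ℝ}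
    (ha : LinearGrowth a) (hb : QuadraticDecay b) (hc : QuadraticDecay c)
    (ha' : LinearGrowth a') (hb' : QuadraticDecay b') (hc' : QuadraticDecay c')
    (ma : ∀ t, Continuous (a t)) (mb : ∀ t, Continuous (b t)) (mc : ∀ t, Continuous (c t))
    (ma' : ∀ t, Continuous (a' t)) (mb' : ∀ t, Continuous (b' t)) (mc' : ∀ t, Continuous (c' t))
    (da : ∀ t x, HasDerivAt (fun s => a s x) (a' t x) t)
    (db : ∀ t x, HasDerivAt (fun s => b s x) (b' t x) t)
    (dc : ∀ t x, HasDerivAt (fun s => c s x) (c' t x) t) (t : ℝ) :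
    HasDerivAt (fun s => ∫ x, a s x * (b s x * c s x))
      (∫ x, (a' t x * (b t x * c t x) + a t x * (b' t x * c t x) + a t x * (b t x * c' t x))) t := by
  obtain ⟨M₁, hM₁⟩ := ha'.exists_bound_mul hb hc (|t| + 1)
  obtain ⟨M₂, hM₂⟩ := ha.exists_bound_mul hb' hc (|t| + 1)
  obtain ⟨M₃, hM₃⟩ := ha.exists_bound_mul hb hc' (|t| + 1)
  have hsub : ∀ s ∈ Metric.ball t 1, s ∈ Set.Icc (-(|t| + 1)) (|t| + 1) := by
    intro s hs
    rw [Real.ball_eq_Ioo] at hs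
    exact ⟨by linarith [hs.1, neg_abs_le t], by linarith [hs.2, le_abs_self t]⟩
  refine (hasDerivAt_integral_of_dominated_loc_of_deriv_le
    (F := fun s x => a s x * (b s x * c s x))
    (F' := fun s x => a' s x * (b s x * c s x) + a s x * (b' s x * c s x)
      + a s x * (b s x * c' s x))
    (bound := fun x => (M₁ + M₂ + M₃) * (1 + x ^ 2)⁻¹)
    (Metric.ball_mem_nhds t one_pos)
    (.of_forall fun s => ?_) (ha.integrable_mul hb hc (ma t) (mb t) (mc t)) ?_
    (.of_forall fun x s hs => ?_) (integrable_inv_one_add_sq.const_mul _)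
    (.of_forall fun x s hs => ?_)).2
  · have := ma s; have := mb s; have := mc s
    exact (by fun_prop : Continuous _).aestronglyMeasurable
  · have := ma t; have := mb t; have := mc t
    have := ma' t; have := mb' t; have := mc' t
    exact (by fun_prop : Continuous _).aestronglyMeasurable
  · rw [add_mul, add_mul]
    exact (norm_add₃_le).trans (add_le_add_three (hM₁ s (hsub s hs) x) (hM₂ s (hsub s hs) x)
      (hM₃ s (hsub s hs) x))
  · refine ((da s x).mul ((db s x).mul (dc s x))).congr_deriv ?_
    simp only [Pi.mul_apply]
    ring

section PartialDerivatives

variable {w : ℝ → ℝ → ℝ}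

lemma hasDerivAt_slice_right (hw : ContDiff ℝ (⊤ : ℕ∞) (fun q : ℝ × ℝ => w q.1 q.2)) (t x : ℝ) :
    HasDerivAt (w t) (fderiv ℝ (fun q : ℝ × ℝ => w q.1 q.2) (t, x) (0, 1)) x :=
  ((hw.differentiable (by simp)) (t, x)).hasFDerivAt.comp_hasDerivAt x
    ((hasDerivAt_const x t).prodMk (hasDerivAt_id x))

lemma hasDerivAt_slice_left (hw : ContDiff ℝ (⊤ : ℕ∞) (fun q : ℝ × ℝ => w q.1 q.2)) (t x : ℝ) :
    HasDerivAt (fun s => w s x) (fderiv ℝ (fun q : ℝ × ℝ => w q.1 q.2) (t, x) (1, 0)) t :=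
  ((hw.differentiable (by simp)) (t, x)).hasFDerivAt.comp_hasDerivAt (f := fun s => (s, x)) t
    ((hasDerivAt_id t).prodMk (hasDerivAt_const t x))

lemma contDiff_deriv_right (hw : ContDiff ℝ (⊤ : ℕ∞) (fun q : ℝ × ℝ => w q.1 q.2)) :
    ContDiff ℝ (⊤ : ℕ∞) (fun q : ℝ × ℝ => deriv (w q.1) q.2) := by
  simp_rw [fun t x => (hasDerivAt_slice_right hw t x).deriv]
  exact (hw.fderiv_right (m := (⊤ : ℕ∞)) (by simp)).clm_apply contDiff_const

lemma contDiff_deriv_left (hw : ContDiff ℝ (⊤ : ℕ∞) (fun q : ℝ × ℝ => w q.1 q.2)) :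
    ContDiff ℝ (⊤ : ℕ∞) (fun q : ℝ × ℝ => deriv (fun s => w s q.2) q.1) := by
  simp_rw [fun t x => (hasDerivAt_slice_left hw t x).deriv]
  exact (hw.fderiv_right (m := (⊤ : ℕ∞)) (by simp)).clm_apply contDiff_const

lemma continuous_slice (hw : ContDiff ℝ (⊤ : ℕ∞) (fun q : ℝ × ℝ => w q.1 q.2)) (t : ℝ) :
    Continuous (w t) :=
  hw.continuous.comp (by fun_prop : Continuous fun x : ℝ => (t, x))

lemma deriv_left_deriv_right (hw : ContDiff ℝ (⊤ : ℕ∞) (fun q : ℝ × ℝ => w q.1 q.2)) (t x : ℝ) :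
    deriv (fun s => deriv (w s) x) t = deriv (fun y => deriv (fun s => w s y) t) x := by
  have hD : DifferentiableAt ℝ (fderiv ℝ (fun q : ℝ × ℝ => w q.1 q.2)) (t, x) :=
    (hw.fderiv_right (m := (⊤ : ℕ∞)) (by simp)).differentiable (by simp) _
  have hsymm : IsSymmSndFDerivAt ℝ (fun q : ℝ × ℝ => w q.1 q.2) (t, x) :=
    hw.contDiffAt.isSymmSndFDerivAt (by
      rw [minSmoothness_of_isRCLikeNormedField]; exact WithTop.coe_le_coe.2 le_top)
  simp_rw [fun t x => (hasDerivAt_slice_right hw t x).deriv,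
    fun t x => (hasDerivAt_slice_left hw t x).deriv]
  have h1 := (hD.hasFDerivAt.comp_hasDerivAt (f := fun s => (s, x)) t
    ((hasDerivAt_id t).prodMk (hasDerivAt_const t x))).clm_apply
      (hasDerivAt_const t ((0, 1) : ℝ × ℝ))
  have h2 := (hD.hasFDerivAt.comp_hasDerivAt x
    ((hasDerivAt_const x t).prodMk (hasDerivAt_id x))).clm_apply
      (hasDerivAt_const x ((1, 0) : ℝ × ℝ))
  have e1 := h1.deriv
  have e2 := h2.deriv
  simp only [Function.comp_def, map_zero, add_zero] at e1 e2
  rw [e1, e2]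
  exact hsymm _ _

end PartialDerivatives

section Sech

lemma hasDerivAt_sech_sq (y : ℝ) :
    HasDerivAt (fun z => sech z ^ 2) (-2 * Real.sinh y / Real.cosh y ^ 3) y := by
  have hc := (Real.cosh_pos y).ne'
  refine (((hasDerivAt_const y (1 : ℝ)).div (Real.hasDerivAt_cosh y) hc).pow 2).congr_deriv ?_
  norm_num
  field_simp

lemma hasDerivAt_deriv_sech_sq (y : ℝ) :
    HasDerivAt (fun z => -2 * Real.sinh z / Real.cosh z ^ 3)
      (-2 / Real.cosh y ^ 2 + 6 * Real.sinh y ^ 2 / Real.cosh y ^ 4) y := by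
  have hc := (Real.cosh_pos y).ne'
  refine (((Real.hasDerivAt_sinh y).const_mul (-2)).div ((Real.hasDerivAt_cosh y).pow 3)
    (pow_ne_zero 3 hc)).congr_deriv ?_
  simp only [Pi.pow_apply]
  field_simp
  ring

lemma abs_sinh_le_cosh (y : ℝ) : |Real.sinh y| ≤ Real.cosh y :=
  abs_le_of_sq_le_sq (by rw [Real.sinh_sq]; linarith) (Real.cosh_pos y).le

lemma abs_sech_sq_le (y : ℝ) : |sech y ^ 2| ≤ 1 := by
  have hc := Real.one_le_cosh y
  rw [sech, div_pow, one_pow, abs_of_nonneg (by positivity)]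
  exact div_le_one_of_le₀ (one_le_pow₀ hc) (by positivity)

lemma abs_deriv_sech_sq_le (y : ℝ) : |-2 * Real.sinh y / Real.cosh y ^ 3| ≤ 2 := by
  have hc := Real.one_le_cosh y
  have hs := abs_sinh_le_cosh y
  rw [abs_div, abs_mul, abs_of_pos (show 0 < Real.cosh y ^ 3 by positivity),
    div_le_iff₀ (by positivity)]
  have : Real.cosh y ≤ Real.cosh y ^ 3 := le_self_pow₀ hc (by norm_num)
  norm_num
  linarith

lemma abs_deriv_deriv_sech_sq_le (y : ℝ) :
    |-2 / Real.cosh y ^ 2 + 6 * Real.sinh y ^ 2 / Real.cosh y ^ 4| ≤ 8 := by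
  have hc := Real.one_le_cosh y
  have hc2 : 1 ≤ Real.cosh y ^ 2 := one_le_pow₀ hc
  have h1 : 2 / Real.cosh y ^ 2 ≤ 2 := by
    rw [div_le_iff₀ (by positivity)]
    linarith
  have h2 : 6 * Real.sinh y ^ 2 / Real.cosh y ^ 4 ≤ 6 := by
    rw [div_le_iff₀ (by positivity), Real.sinh_sq]
    nlinarith
  have h3 : 0 ≤ 2 / Real.cosh y ^ 2 := by positivity
  have h4 : 0 ≤ 6 * Real.sinh y ^ 2 / Real.cosh y ^ 4 := by positivity
  rw [neg_div, abs_le]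
  constructor <;> linarith

end Sech

lemma LinearGrowth.of_rescaled {c lam h : ℝ → ℝ} (hc : Continuous c) {C : ℝ}
    (hh : ∀ y, |h y| ≤ C) : LinearGrowth (fun t x => c t * h (x / lam t)) := by
  intro T
  obtain ⟨A, hA⟩ := isCompact_Icc.exists_bound_of_continuousOn (s := Set.Icc (-T) T) hc.continuousOn
  refine ⟨A * C, fun t ht x => ?_⟩
  have hA' : |c t| ≤ A := hA t ht
  have hA0 : 0 ≤ A := (abs_nonneg _).trans hA'
  have hC0 : 0 ≤ C := (abs_nonneg _).trans (hh 0)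
  rw [abs_mul]
  calc |c t| * |h (x / lam t)| ≤ A * C := mul_le_mul hA' (hh _) (abs_nonneg _) hA0
    _ ≤ A * C * (1 + |x|) := le_mul_of_one_le_right (by positivity) (by linarith [abs_nonneg x])

lemma LinearGrowth.of_rescaled_mul {c lam h : ℝ → ℝ} (hc : Continuous c) {C : ℝ}
    (hh : ∀ y, |h y| ≤ C) : LinearGrowth (fun t x => c t * x * h (x / lam t)) := by
  intro T
  obtain ⟨A, hA⟩ := isCompact_Icc.exists_bound_of_continuousOn (s := Set.Icc (-T) T) hc.continuousOn
  refine ⟨A * C, fun t ht x => ?_⟩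
  have hA' : |c t| ≤ A := hA t ht
  have hA0 : 0 ≤ A := (abs_nonneg _).trans hA'
  have hC0 : 0 ≤ C := (abs_nonneg _).trans (hh 0)
  rw [abs_mul, abs_mul]
  calc |c t| * |x| * |h (x / lam t)| ≤ A * |x| * C := by
        gcongr
        exact hh _
    _ = A * C * |x| := by ring
    _ ≤ A * C * (1 + |x|) := by
        gcongr
        linarith

lemma LinearGrowth.add {g h : ℝ → ℝ → ℝ} (hg : LinearGrowth g) (hh : LinearGrowth h) :
    LinearGrowth (fun t x => g t x + h t x) := by
  intro T
  obtain ⟨M, hM⟩ := hg T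
  obtain ⟨N, hN⟩ := hh T
  refine ⟨M + N, fun t ht x => ?_⟩
  linarith [hM t ht x, hN t ht x, abs_add_le (g t x) (h t x)]

/-- The rescaled weight `(1 / λ) sech² (x / λ)` has time and space derivatives of at most linear
growth. -/
lemma rescaled_sech_sq_weight {lam : ℝ → ℝ} (hlam : ContDiff ℝ (⊤ : ℕ∞) lam)
    (hlampos : ∀ t, 0 < lam t) {φ : ℝ → ℝ → ℝ}
    (hφ : φ = fun t x => (1 / lam t) * sech (x / lam t) ^ 2) :
    ∃ φt φx φxx : ℝ → ℝ → ℝ,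
      (∀ t x, HasDerivAt (fun s => φ s x) (φt t x) t) ∧
      (∀ t x, HasDerivAt (φ t) (φx t x) x) ∧
      (∀ t x, HasDerivAt (φx t) (φxx t x) x) ∧
      LinearGrowth φ ∧ LinearGrowth φt ∧ LinearGrowth φx ∧ LinearGrowth φxx ∧
      (∀ t, Continuous (φt t)) ∧ (∀ t, Continuous (φxx t)) := by
  have hne : ∀ t, lam t ≠ 0 := fun t => (hlampos t).ne'
  have hcl : Continuous lam := hlam.continuous
  have hcl' : Continuous (deriv lam) := hlam.continuous_deriv (by simp)
  have hg : Continuous fun z => sech z ^ 2 :=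
    continuous_iff_continuousAt.2 fun z => (hasDerivAt_sech_sq z).continuousAt
  have hg' : Continuous fun z => -2 * Real.sinh z / Real.cosh z ^ 3 :=
    continuous_iff_continuousAt.2 fun z => (hasDerivAt_deriv_sech_sq z).continuousAt
  have hg'' : Continuous fun z => -2 / Real.cosh z ^ 2 + 6 * Real.sinh z ^ 2 / Real.cosh z ^ 4 := by
    have := Real.continuous_cosh
    have := Real.continuous_sinh
    exact ((continuous_const.div (by fun_prop) fun z => pow_ne_zero 2 (Real.cosh_pos z).ne').add
      (Continuous.div (by fun_prop) (by fun_prop) fun z => pow_ne_zero 4 (Real.cosh_pos z).ne'))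
  have hscale : ∀ t : ℝ, Continuous fun x => x / lam t := fun t => continuous_id.div_const _
  have hdscale : ∀ t x : ℝ, HasDerivAt (fun y => y / lam t) (1 / lam t) x :=
    fun t x => (hasDerivAt_id x).div_const _
  refine ⟨fun t x => -(deriv lam t) / lam t ^ 2 * (fun z => sech z ^ 2) (x / lam t)
      + -(deriv lam t) / lam t ^ 3 * x
        * (fun z => -2 * Real.sinh z / Real.cosh z ^ 3) (x / lam t),
    fun t x => 1 / lam t ^ 2 * (fun z => -2 * Real.sinh z / Real.cosh z ^ 3) (x / lam t),
    fun t x => 1 / lam t ^ 3 *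
      (fun z => -2 / Real.cosh z ^ 2 + 6 * Real.sinh z ^ 2 / Real.cosh z ^ 4) (x / lam t),
    fun t x => ?_, fun t x => ?_, fun t x => ?_, ?_, ?_, ?_, ?_, fun t => ?_, fun t => ?_⟩
  · have hl : HasDerivAt lam (deriv lam t) t := (hlam.differentiable (by simp) t).hasDerivAt
    have hin := (hasDerivAt_const t x).div hl (hne t)
    have h1 := ((hasDerivAt_const t (1 : ℝ)).div hl (hne t)).mul
      ((hasDerivAt_sech_sq (x / lam t)).comp t hin)
    rw [hφ]
    refine h1.congr_deriv ?_
    have := hne t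
    simp only [Function.comp_def, Pi.div_apply]
    field_simp
    ring
  · rw [hφ]
    refine (((hasDerivAt_sech_sq (x / lam t)).comp x (hdscale t x)).const_mul _).congr_deriv ?_
    have := hne t
    field_simp
  · refine (((hasDerivAt_deriv_sech_sq (x / lam t)).comp x
      (hdscale t x)).const_mul _).congr_deriv ?_
    have := hne t
    ring
  · rw [hφ]
    exact LinearGrowth.of_rescaled (h := fun z => sech z ^ 2)
      (continuous_const.div hcl hne) abs_sech_sq_le
  · exact (LinearGrowth.of_rescaled
      (hcl'.neg.div (hcl.pow 2) fun t => pow_ne_zero 2 (hne t)) abs_sech_sq_le).add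
      (LinearGrowth.of_rescaled_mul
        (hcl'.neg.div (hcl.pow 3) fun t => pow_ne_zero 3 (hne t)) abs_deriv_sech_sq_le)
  · exact LinearGrowth.of_rescaled
      (continuous_const.div (hcl.pow 2) fun t => pow_ne_zero 2 (hne t)) abs_deriv_sech_sq_le
  · exact LinearGrowth.of_rescaled
      (continuous_const.div (hcl.pow 3) fun t => pow_ne_zero 3 (hne t)) abs_deriv_deriv_sech_sq_le
  · exact (continuous_const.mul (hg.comp (hscale t))).add
      ((continuous_const.mul continuous_id).mul (hg'.comp (hscale t)))
  · exact continuous_const.mul (hg''.comp (hscale t))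

lemma integral_virial_combination {F A₁ A₂ A₃ A₄ A₅ A₆ B : ℝ → ℝ}
    (h₁ : Integrable A₁) (h₂ : Integrable A₂) (h₃ : Integrable A₃) (h₄ : Integrable A₄)
    (h₅ : Integrable A₅) (h₆ : Integrable A₆) (hB : Integrable B) (hB0 : ∫ x, B x = 0)
    (hF : ∀ x, F x = A₁ x - A₂ x + A₃ x + (1 / 2) * A₄ x + A₅ x - A₆ x + B x) :
    ∫ x, F x = (∫ x, A₁ x) - (∫ x, A₂ x) + (∫ x, A₃ x) + (1 / 2) * (∫ x, A₄ x)
      + (∫ x, A₅ x) - (∫ x, A₆ x) := by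
  simp_rw [hF]
  rw [integral_add (by fun_prop) hB, integral_sub (by fun_prop) h₆,
    integral_add (by fun_prop) h₅, integral_add (by fun_prop) (by fun_prop),
    integral_add (by fun_prop) h₃, integral_sub h₁ h₂, integral_const_mul, hB0, add_zero]

/-- Second Virial identity \eqref{I_p}. -/
theorem stmt_11 (p K : ℝ) (hp : 1 < p) (hK : 0 < K)
    (f : ℝ → ℝ) (hf : ContDiff ℝ (⊤ : ℕ∞) f) (hf0 : f 0 = 0)
    (hfp : ∀ s : ℝ, |s| ≤ 1 → |deriv f s| ≤ K * |s| ^ (p - 1))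
    (u₁ u₂ : ℝ → ℝ → ℝ)
    (hu₁ : ContDiff ℝ (⊤ : ℕ∞) (fun q : ℝ × ℝ => u₁ q.1 q.2))
    (hu₂ : ContDiff ℝ (⊤ : ℕ∞) (fun q : ℝ × ℝ => u₂ q.1 q.2))
    (heq₁ : ∀ t x : ℝ, deriv (fun s => u₁ s x) t = deriv (u₂ t) x)
    (heq₂ : ∀ t x : ℝ, deriv (fun s => u₂ s x) t
      = deriv (fun y => u₁ t y - deriv (deriv (u₁ t)) y - f (u₁ t y)) x)
    (hdec₁ : ∀ T : ℝ, ∀ m k n : ℕ, ∃ M : ℝ, ∀ t ∈ Set.Icc (-T) T, ∀ x : ℝ,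
      (1 + |x|) ^ n * |iteratedDeriv k (fun y => iteratedDeriv m (fun s => u₁ s y) t) x| ≤ M)
    (hdec₂ : ∀ T : ℝ, ∀ m k n : ℕ, ∃ M : ℝ, ∀ t ∈ Set.Icc (-T) T, ∀ x : ℝ,
      (1 + |x|) ^ n * |iteratedDeriv k (fun y => iteratedDeriv m (fun s => u₂ s y) t) x| ≤ M)
    (lam : ℝ → ℝ) (hlam : ContDiff ℝ (⊤ : ℕ∞) lam) (hlampos : ∀ t : ℝ, 0 < lam t)
    (φ : ℝ → ℝ → ℝ) (hφ : φ = fun t x => (1 / lam t) * sech (x / lam t) ^ 2) :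
    ∀ t : ℝ, HasDerivAt (fun s => ∫ x : ℝ, φ s x * (deriv (u₁ s) x * u₂ s x))
      ((∫ x : ℝ, deriv (fun s => φ s x) t * (deriv (u₁ t) x * u₂ t x))
        - (∫ x : ℝ, φ t x * (deriv (u₂ t) x) ^ 2)
        + (∫ x : ℝ, φ t x * (deriv (deriv (u₁ t)) x) ^ 2)
        + (1 / 2) * (∫ x : ℝ, deriv (deriv (φ t)) x * (u₂ t x) ^ 2)
        + (∫ x : ℝ, (φ t x - (1 / 2) * deriv (deriv (φ t)) x) * (deriv (u₁ t) x) ^ 2)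
        - (∫ x : ℝ, φ t x * (deriv (u₁ t) x) ^ 2 * deriv f (u₁ t x))) t := by
  intro t
  obtain ⟨φt, φx, φxx, dφt, dφx, dφxx, gφ, gφt, gφx, gφxx, cφt, cφxx⟩ :=
    rescaled_sech_sq_weight hlam hlampos hφ
  have cφ : ∀ t, Continuous (φ t) := fun t =>
    continuous_iff_continuousAt.2 fun x => (dφx t x).continuousAt
  have cφx : ∀ t, Continuous (φx t) := fun t =>
    continuous_iff_continuousAt.2 fun x => (dφxx t x).continuousAt
  have hφx : ∀ t, deriv (φ t) = φx t := fun t => funext fun x => (dφx t x).deriv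
  have hφxx : ∀ t x, deriv (deriv (φ t)) x = φxx t x := fun t x => by
    rw [hφx, (dφxx t x).deriv]
  have su₁x := contDiff_deriv_right hu₁
  have su₁xx := contDiff_deriv_right (w := fun t => deriv (u₁ t)) su₁x
  have su₁xxx := contDiff_deriv_right (w := fun t => deriv (deriv (u₁ t))) su₁xx
  have su₂x := contDiff_deriv_right hu₂
  have su₂xx := contDiff_deriv_right (w := fun t => deriv (u₂ t)) su₂x
  have su₂t := contDiff_deriv_left hu₂
  have q₁x : QuadraticDecay (fun t x => deriv (u₁ t) x) := fun T => by
    simpa [iteratedDeriv_succ] using hdec₁ T 0 1 2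
  have q₁xx : QuadraticDecay (fun t x => deriv (deriv (u₁ t)) x) := fun T => by
    simpa [iteratedDeriv_succ] using hdec₁ T 0 2 2
  have q₁xxx : QuadraticDecay (fun t x => deriv (deriv (deriv (u₁ t))) x) := fun T => by
    simpa [iteratedDeriv_succ] using hdec₁ T 0 3 2
  have q₂ : QuadraticDecay u₂ := fun T => by
    simpa [iteratedDeriv_succ] using hdec₂ T 0 0 2
  have q₂x : QuadraticDecay (fun t x => deriv (u₂ t) x) := fun T => by
    simpa [iteratedDeriv_succ] using hdec₂ T 0 1 2
  have q₂xx : QuadraticDecay (fun t x => deriv (deriv (u₂ t)) x) := fun T => by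
    simpa [iteratedDeriv_succ] using hdec₂ T 0 2 2
  have q₂t : QuadraticDecay (fun t x => deriv (fun s => u₂ s x) t) := fun T => by
    simpa [iteratedDeriv_succ] using hdec₂ T 1 0 2
  have d₁ := fun t x => (hasDerivAt_slice_right hu₁ t x).differentiableAt.hasDerivAt
  have d₁x := fun t x => (hasDerivAt_slice_right (w := fun t => deriv (u₁ t)) su₁x t x).differentiableAt.hasDerivAt
  have d₁xx := fun t x => (hasDerivAt_slice_right (w := fun t => deriv (deriv (u₁ t))) su₁xx t x).differentiableAt.hasDerivAt
  have d₂ := fun t x => (hasDerivAt_slice_right hu₂ t x).differentiableAt.hasDerivAt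
  have d₂x := fun t x => (hasDerivAt_slice_right (w := fun t => deriv (u₂ t)) su₂x t x).differentiableAt.hasDerivAt
  have d₂t := fun t x => (hasDerivAt_slice_left hu₂ t x).differentiableAt.hasDerivAt
  have d₁xt : ∀ t x, HasDerivAt (fun s => deriv (u₁ s) x) (deriv (deriv (u₂ t)) x) t := by
    intro t x
    have h := (hasDerivAt_slice_left (w := fun t => deriv (u₁ t)) su₁x t x).differentiableAt.hasDerivAt
    rw [deriv_left_deriv_right hu₁] at h
    simpa only [heq₁] using h
  have hnl : ∀ t x, deriv f (u₁ t x) * deriv (u₁ t) x =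
      deriv (u₁ t) x - deriv (deriv (deriv (u₁ t))) x - deriv (fun s => u₂ s x) t := by
    intro t x
    have hfd := (hf.differentiable (by simp) (u₁ t x)).hasDerivAt.comp x (d₁ t x)
    have h := (((d₁ t x).sub (d₁xx t x)).sub hfd).deriv
    have h' := heq₂ t x
    rw [show (fun y => u₁ t y - deriv (deriv (u₁ t)) y - f (u₁ t y))
      = u₁ t - (fun y => deriv (deriv (u₁ t)) y) - f ∘ u₁ t from rfl, h] at h'
    linarith
  have qnl : QuadraticDecay (fun t x => deriv f (u₁ t x) * deriv (u₁ t) x) := by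
    simp_rw [hnl]
    exact (q₁x.sub q₁xxx).sub q₂t
  have c₁x := continuous_slice (w := fun t => deriv (u₁ t)) su₁x
  have c₁xx := continuous_slice (w := fun t => deriv (deriv (u₁ t))) su₁xx
  have c₁xxx := continuous_slice (w := fun t => deriv (deriv (deriv (u₁ t)))) su₁xxx
  have c₂ := continuous_slice hu₂
  have c₂x := continuous_slice (w := fun t => deriv (u₂ t)) su₂x
  have c₂xx := continuous_slice (w := fun t => deriv (deriv (u₂ t))) su₂xx
  have c₂t := continuous_slice (w := fun t x => deriv (fun s => u₂ s x) t) su₂t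
  have cnl : ∀ t, Continuous (fun x => deriv f (u₁ t x) * deriv (u₁ t) x) := fun t =>
    ((hf.continuous_deriv (by simp)).comp (continuous_slice hu₁ t)).mul (c₁x t)
  refine (gφ.hasDerivAt_integral_mul q₁x q₂ gφt q₂xx q₂t cφ c₁x c₂ cφt c₂xx c₂t
    dφt d₁xt d₂t t).congr_deriv ?_
  simp_rw [hφxx, fun x => (dφt t x).deriv]
  have i₁₁ := gφ.integrable_mul q₁x q₁x (cφ t) (c₁x t) (c₁x t)
  have i₁₁xx := gφxx.integrable_mul q₁x q₁x (cφxx t) (c₁x t) (c₁x t)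
  have i₂₂xx := gφxx.integrable_mul q₂ q₂ (cφxx t) (c₂ t) (c₂ t)
  have i₂x₂x := gφ.integrable_mul q₂x q₂x (cφ t) (c₂x t) (c₂x t)
  have i₁xx := gφ.integrable_mul q₁xx q₁xx (cφ t) (c₁xx t) (c₁xx t)
  have j₂ := gφ.integrable_mul q₂xx q₂ (cφ t) (c₂xx t) (c₂ t)
  have j₄ := gφ.integrable_mul q₁x q₁xxx (cφ t) (c₁x t) (c₁xxx t)
  -- the flux whose derivative collects the boundary terms of the integrations by parts
  let Q : ℝ → ℝ := fun x => φ t x * (deriv (u₂ t) x * u₂ t x)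
    - (1 / 2) * (φx t x * (u₂ t x * u₂ t x))
    - φ t x * (deriv (u₁ t) x * deriv (deriv (u₁ t)) x)
    + (1 / 2) * (φx t x * (deriv (u₁ t) x * deriv (u₁ t) x))
  let Q' : ℝ → ℝ := fun x => φ t x * (deriv (deriv (u₂ t)) x * u₂ t x)
    + φ t x * (deriv (u₂ t) x * deriv (u₂ t) x)
    - (1 / 2) * (φxx t x * (u₂ t x * u₂ t x))
    - φ t x * (deriv (deriv (u₁ t)) x * deriv (deriv (u₁ t)) x)
    - φ t x * (deriv (u₁ t) x * deriv (deriv (deriv (u₁ t))) x)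
    + (1 / 2) * (φxx t x * (deriv (u₁ t) x * deriv (u₁ t) x))
  have hQ : ∀ x, HasDerivAt Q (Q' x) x := by
    intro x
    refine (((((dφx t x).mul ((d₂x t x).mul (d₂ t x))).sub
      (((dφxx t x).mul ((d₂ t x).mul (d₂ t x))).const_mul (1 / 2))).sub
      ((dφx t x).mul ((d₁x t x).mul (d₁xx t x)))).add
      (((dφxx t x).mul ((d₁x t x).mul (d₁x t x))).const_mul (1 / 2))).congr_deriv ?_
    simp only [Q', Pi.mul_apply]
    ring
  have iQ : Integrable Q :=
    (((gφ.integrable_mul q₂x q₂ (cφ t) (c₂x t) (c₂ t)).sub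
      ((gφx.integrable_mul q₂ q₂ (cφx t) (c₂ t) (c₂ t)).const_mul (1 / 2))).sub
      (gφ.integrable_mul q₁x q₁xx (cφ t) (c₁x t) (c₁xx t))).add
      ((gφx.integrable_mul q₁x q₁x (cφx t) (c₁x t) (c₁x t)).const_mul (1 / 2))
  have iQ' : Integrable Q' :=
    ((((j₂.add i₂x₂x).sub (i₂₂xx.const_mul (1 / 2))).sub i₁xx).sub j₄).add
      (i₁₁xx.const_mul (1 / 2))
  refine integral_virial_combination (B := Q')
    (gφt.integrable_mul q₁x q₂ (cφt t) (c₁x t) (c₂ t))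
    (by simpa only [sq] using i₂x₂x) (by simpa only [sq] using i₁xx)
    (by simpa only [sq] using i₂₂xx) ?_ ?_ iQ'
    (integral_eq_zero_of_hasDerivAt_of_integrable hQ iQ' iQ) fun x => ?_
  · refine (i₁₁.sub (i₁₁xx.const_mul (1 / 2))).congr (.of_forall fun x => ?_)
    simp only [Pi.sub_apply]
    ring
  · refine (gφ.integrable_mul q₁x qnl (cφ t) (c₁x t) (cnl t)).congr (.of_forall fun x => ?_)
    simp only
    ring
  · have h := hnl t x
    simp only [Q']
    linear_combination (φ t x * deriv (u₁ t) x) * h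
end
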